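/- For n ≥ 3m and any ideal A ⊴ R, the group E∧^m E(n,R,A) = ∧^m E(n,R) · E(N,R,A) is perfect, i.e., equals its own commutator subgroup. -/

import Mathlib

open Matrix

abbrev Idx (n m : ℕ) := {s : Finset (Fin n) // s.card = m}

def extPow {R : Type*} [CommRing R] (n m : ℕ) (x : Matrix (Fin n) (Fin n) R) :
    Matrix (Idx n m) (Idx n m) R :=
  fun I J => (x.submatrix (⇑(I.1.orderEmbOfFin I.2)) (⇑(J.1.orderEmbOfFin J.2))).det

/-- The elementary transvection `t_{I,J}(ξ) = e + ξ e_{I,J}` as an element of `GL ι R`. -/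
def tGL {R : Type*} [CommRing R] {ι : Type*} [Fintype ι] [DecidableEq ι] {I J : ι}
    (h : I ≠ J) (ξ : R) : GL ι R where
  val := Matrix.transvection I J ξ
  inv := Matrix.transvection I J (-ξ)
  val_inv := by
    rw [Matrix.transvection_mul_transvection_same _ _ h, add_neg_cancel]
    simp [Matrix.transvection]
  inv_val := by
    rw [Matrix.transvection_mul_transvection_same _ _ h, neg_add_cancel]
    simp [Matrix.transvection]

/-- `E(N, A)`: the subgroup generated by all elementary transvections of level `A`. -/
def elemSub (R : Type*) [CommRing R] (ι : Type*) [Fintype ι] [DecidableEq ι]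
    (A : Ideal R) : Subgroup (GL ι R) :=
  Subgroup.closure {g | ∃ (I J : ι) (h : I ≠ J) (ξ : R), ξ ∈ A ∧ g = tGL h ξ}

/-- `E(N, R)`: the (absolute) elementary subgroup. -/
def elemSubFull (R : Type*) [CommRing R] (ι : Type*) [Fintype ι] [DecidableEq ι] :
    Subgroup (GL ι R) :=
  Subgroup.closure {g | ∃ (I J : ι) (h : I ≠ J) (ξ : R), g = tGL h ξ}

/-- The smallest subgroup containing `S` and normalized by `F`: the closure `S^F`. -/
def closUnder {G : Type*} [Group G] (S F : Subgroup G) : Subgroup G :=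
  Subgroup.closure {g | ∃ x ∈ S, ∃ f ∈ F, g = f * x * f⁻¹}

/-- `E(N, R, A)`: the relative elementary subgroup, the normal closure of `E(N,A)`
in `E(N,R)`. -/
def relElemSub (R : Type*) [CommRing R] (ι : Type*) [Fintype ι] [DecidableEq ι]
    (A : Ideal R) : Subgroup (GL ι R) :=
  closUnder (elemSub R ι A) (elemSubFull R ι)

/-- `∧^m E(n,R)`: the image of the elementary group `E(n,R)` under the Cauchy–Binet
homomorphism, as a subgroup of `GL_{binom(n,m)}(R)`. -/
def wedgeElem (R : Type*) [CommRing R] (n m : ℕ) : Subgroup (GL (Idx n m) R) :=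
  Subgroup.closure
    {g | ∃ (i j : Fin n) (_ : i ≠ j) (ξ : R),
      (g : Matrix (Idx n m) (Idx n m) R) = extPow n m (Matrix.transvection i j ξ)}

/-- `Idx n m` is the index type of the exterior power basis. -/
def idxEquiv (n m : ℕ) : Idx n m ≃ Set.powersetCard (Fin n) m where
  toFun I := ⟨I.1, Set.powersetCard.mem_iff.2 I.2⟩
  invFun I := ⟨I.1, Set.powersetCard.mem_iff.1 I.2⟩
  left_inv _ := rfl
  right_inv _ := rfl

/-- The exterior power basis indexed by `Idx n m`. -/
noncomputable def idxBasis (R : Type*) [CommRing R] (n m : ℕ) :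
    Module.Basis (Idx n m) R (⋀[R]^m (Fin n → R)) :=
  ((Pi.basisFun R (Fin n)).exteriorPower m).reindex (idxEquiv n m).symm

/-- Minors are coordinates in the exterior power basis. -/
lemma extPow_eq_coord {R : Type*} [CommRing R] (n m : ℕ) (x : Matrix (Fin n) (Fin n) R)
    (I J : Idx n m) :
    extPow n m x I J = (idxBasis R n m).repr
      (exteriorPower.map m (Matrix.toLin' x) (idxBasis R n m J)) I := by
  unfold idxBasis
  rw [Module.Basis.repr_reindex_apply, Module.Basis.reindex_apply, Equiv.symm_symm]
  rw [exteriorPower.basis_repr_apply, exteriorPower.basis_apply]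
  rw [exteriorPower.map_apply_ιMulti_family, exteriorPower.ιMulti_family,
    exteriorPower.ιMultiDual_apply_ιMulti]
  rw [← Matrix.det_transpose]
  unfold extPow
  congr 1
  ext a b
  simp [Set.powersetCard.ofFinEmbEquiv_symm_apply, Matrix.toLin'_apply, idxEquiv]

lemma extPow_mul {R : Type*} [CommRing R] (n m : ℕ) (x y : Matrix (Fin n) (Fin n) R) :
    extPow n m (x * y) = extPow n m x * extPow n m y := by
  ext I J
  rw [Matrix.mul_apply, extPow_eq_coord, Matrix.toLin'_mul, exteriorPower.map_comp,
    LinearMap.comp_apply]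
  have h := (idxBasis R n m).sum_repr (exteriorPower.map m (Matrix.toLin' y) (idxBasis R n m J))
  rw [← h]
  simp only [map_sum, map_smul, Finsupp.coe_finsetSum, Finset.sum_apply, Finsupp.smul_apply,
    smul_eq_mul]
  refine Finset.sum_congr rfl fun K _ => ?_
  rw [extPow_eq_coord n m x I K, extPow_eq_coord n m y K J, mul_comm]

lemma extPow_one {R : Type*} [CommRing R] (n m : ℕ) :
    extPow n m (1 : Matrix (Fin n) (Fin n) R) = 1 := by
  ext I J
  rw [extPow_eq_coord, Matrix.toLin'_one, exteriorPower.map_id, LinearMap.id_apply,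
    Module.Basis.repr_self, Matrix.one_apply, Finsupp.single_apply]
  exact if_congr eq_comm rfl rfl

/-- The sign-like off-diagonal entry of the exterior power of a transvection. -/
def sgnX (R : Type*) [CommRing R] {n m : ℕ} (k l : Fin n) (K J : Idx n m) : R :=
  if h : k ∈ K.1 then
    ((1 : Matrix (Fin n) (Fin n) R).submatrix
      (Function.update (K.1.orderEmbOfFin K.2) ((K.1.orderIsoOfFin K.2).symm ⟨k, h⟩) l)
      (J.1.orderEmbOfFin J.2)).det
  else 0

lemma extPow_transvection {R : Type*} [CommRing R] {n m : ℕ} (k l : Fin n) (c : R)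
    (K J : Idx n m) :
    extPow n m (Matrix.transvection k l c) K J =
      (1 : Matrix (Idx n m) (Idx n m) R) K J + c * sgnX R k l K J := by
  rw [← extPow_one n m]
  unfold sgnX
  split_ifs with h
  · set r := (K.1.orderIsoOfFin K.2).symm ⟨k, h⟩ with hr
    have hrk : K.1.orderEmbOfFin K.2 r = k := by
      rw [← Finset.coe_orderIsoOfFin_apply, hr]; simp
    unfold extPow
    set f := K.1.orderEmbOfFin K.2
    set g := J.1.orderEmbOfFin J.2
    set M := (1 : Matrix (Fin n) (Fin n) R).submatrix f g with hM
    have e1 : (Matrix.transvection k l c).submatrix f g =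
        M.updateRow r (M r + c • fun b => (1 : Matrix (Fin n) (Fin n) R) l (g b)) := by
      ext a b
      by_cases ha : a = r
      · subst ha
        simp [Matrix.transvection, M, Matrix.single_apply, Matrix.one_apply, hrk]
      · have : k ≠ f a := fun h' => ha (f.injective (h'.symm.trans hrk.symm))
        simp [Matrix.transvection, M, Matrix.updateRow_ne ha, this]
    have e2 : (1 : Matrix (Fin n) (Fin n) R).submatrix (Function.update f r l) g =
        M.updateRow r (fun b => (1 : Matrix (Fin n) (Fin n) R) l (g b)) := by
      ext a b
      by_cases ha : a = r
      · subst ha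
        rw [Matrix.submatrix_apply, Function.update_self, Matrix.updateRow_self]
      · rw [Matrix.submatrix_apply, Function.update_of_ne ha, Matrix.updateRow_ne ha]
        rfl
    rw [e1, e2, Matrix.det_updateRow_add, Matrix.det_updateRow_smul, Matrix.updateRow_eq_self]
  · rw [mul_zero, add_zero]
    unfold extPow
    congr 1
    ext a b
    have : k ≠ K.1.orderEmbOfFin K.2 a := fun h' => h (h' ▸ Finset.orderEmbOfFin_mem _ _ _)
    simp [Matrix.transvection, this]

/-- Nonvanishing of the off-diagonal entry forces `J = (K \ k) ∪ l`. -/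
lemma sgnX_zero {R : Type*} [CommRing R] {n m : ℕ} (k l : Fin n) (K J : Idx n m)
    (h : ¬ (k ∈ K.1 ∧ l ∉ K.1.erase k ∧ J.1 = insert l (K.1.erase k))) :
    sgnX R k l K J = 0 := by
  unfold sgnX
  split_ifs with hk
  swap
  · rfl
  set r := (K.1.orderIsoOfFin K.2).symm ⟨k, hk⟩ with hr
  have hrk : K.1.orderEmbOfFin K.2 r = k := by
    rw [← Finset.coe_orderIsoOfFin_apply, hr]; simp
  have hsurj : ∀ p ∈ K.1, ∃ a, K.1.orderEmbOfFin K.2 a = p := fun p hp => by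
    have : p ∈ Set.range (K.1.orderEmbOfFin K.2) := by
      rw [Finset.range_orderEmbOfFin]; exact hp
    exact this
  by_cases hl : l ∈ K.1.erase k
  · obtain ⟨hlk, hlK⟩ := Finset.mem_erase.1 hl
    obtain ⟨a, ha⟩ := hsurj l hlK
    have har : a ≠ r := by rintro rfl; exact hlk (ha.symm.trans hrk)
    refine Matrix.det_zero_of_row_eq har ?_
    funext b
    rw [Matrix.submatrix_apply, Matrix.submatrix_apply, Function.update_self,
      Function.update_of_ne har, ha]
  · have hJ : ¬ insert l (K.1.erase k) ⊆ J.1 := fun hs => by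
      refine h ⟨hk, hl, (Finset.eq_of_subset_of_card_le hs ?_).symm⟩
      rw [Finset.card_insert_of_notMem hl, Finset.card_erase_of_mem hk, K.2, J.2]
      omega
    obtain ⟨p, hp, hpJ⟩ := Finset.not_subset.1 hJ
    have : ∃ a, Function.update (K.1.orderEmbOfFin K.2) r l a = p := by
      rcases Finset.mem_insert.1 hp with rfl | hp
      · exact ⟨r, by simp⟩
      · obtain ⟨hpk, hpK⟩ := Finset.mem_erase.1 hp
        obtain ⟨a, ha⟩ := hsurj p hpK
        have har : a ≠ r := by rintro rfl; exact hpk (ha.symm.trans hrk)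
        exact ⟨a, by simp [har, ha]⟩
    obtain ⟨a, ha⟩ := this
    refine Matrix.det_eq_zero_of_row_eq_zero a fun b => ?_
    rw [Matrix.submatrix_apply, ha, Matrix.one_apply_ne]
    rintro rfl
    exact hpJ (Finset.orderEmbOfFin_mem _ _ _)

lemma sgnX_unit {R : Type*} [CommRing R] {n m : ℕ} (k l : Fin n) (K J : Idx n m)
    (hk : k ∈ K.1) (hl : l ∉ K.1) (hJ : J.1 = insert l (K.1.erase k)) :
    IsUnit (sgnX R k l K J) := by
  unfold sgnX
  rw [dif_pos hk]
  set r := (K.1.orderIsoOfFin K.2).symm ⟨k, hk⟩ with hr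
  have hrk : K.1.orderEmbOfFin K.2 r = k := by
    rw [← Finset.coe_orderIsoOfFin_apply, hr]; simp
  set f := Function.update (K.1.orderEmbOfFin K.2) r l with hf
  have hmem : ∀ a, f a ∈ J.1 := fun a => by
    rw [hJ]
    by_cases ha : a = r
    · subst ha; simp [hf]
    · have : f a = K.1.orderEmbOfFin K.2 a := by simp [hf, ha]
      rw [this]
      refine Finset.mem_insert_of_mem (Finset.mem_erase.2 ⟨fun h' => ha ?_,
        Finset.orderEmbOfFin_mem _ _ _⟩)
      exact (K.1.orderEmbOfFin K.2).injective (h'.trans hrk.symm)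
  have hinj : Function.Injective f := by
    intro a b hab
    have key : ∀ c, K.1.orderEmbOfFin K.2 c ≠ l := fun c h' =>
      hl (h' ▸ Finset.orderEmbOfFin_mem _ _ _)
    by_cases ha : a = r <;> by_cases hb : b = r
    · rw [ha, hb]
    · subst ha; simp [hf, hb] at hab; exact absurd hab.symm (key b)
    · subst hb; simp [hf, ha] at hab; exact absurd hab (key a)
    · simpa [hf, ha, hb] using hab
  let s : Fin m → Fin m := fun a => (J.1.orderIsoOfFin J.2).symm ⟨f a, hmem a⟩
  have hs : ∀ a, J.1.orderEmbOfFin J.2 (s a) = f a := fun a => by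
    rw [← Finset.coe_orderIsoOfFin_apply]; simp [s]
  have hsinj : Function.Injective s := fun a b hab => hinj (by rw [← hs, ← hs, hab])
  let σ : Equiv.Perm (Fin m) := Equiv.ofBijective s (Finite.injective_iff_bijective.1 hsinj)
  have : (1 : Matrix (Fin n) (Fin n) R).submatrix f (J.1.orderEmbOfFin J.2) =
      (1 : Matrix (Fin m) (Fin m) R).submatrix σ id := by
    ext a b
    simp [Matrix.one_apply, ← hs, σ]
  rw [this, Matrix.det_permute, Matrix.det_one, mul_one]
  rcases Int.units_eq_one_or (Equiv.Perm.sign σ) with h | h <;> simp [h]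

section elementary

variable {R : Type*} [CommRing R] {ι : Type*} [Fintype ι] [DecidableEq ι]

lemma tGL_zero {i j : ι} (h : i ≠ j) : tGL h (0 : R) = 1 := by
  apply Units.ext
  simp [tGL]

lemma tGL_mul {i j : ι} (h : i ≠ j) (a b : R) : tGL h a * tGL h b = tGL h (a + b) := by
  apply Units.ext
  simp [tGL, Matrix.transvection_mul_transvection_same _ _ h]

lemma tGL_inv {i j : ι} (h : i ≠ j) (a : R) : (tGL h a)⁻¹ = tGL h (-a) := by
  rw [inv_eq_iff_mul_eq_one, tGL_mul, add_neg_cancel, tGL_zero]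

lemma conj_comm {i j k l : ι} (h : i ≠ j) (h' : k ≠ l) (hjk : j ≠ k) (hli : l ≠ i) (a b : R) :
    MulAut.conj (tGL h' b) (tGL h a) = tGL h a := by
  rw [MulAut.conj_apply, mul_inv_eq_iff_eq_mul]
  apply Units.ext
  simp [tGL, Matrix.transvection, mul_add, add_mul, Matrix.single_mul_single_of_ne, hjk, hli]
  abel

lemma conj_right {i j l : ι} (hij : i ≠ j) (hjl : j ≠ l) (hil : i ≠ l) (a b : R) :
    MulAut.conj (tGL hjl b) (tGL hij a) = tGL hil (-(a * b)) * tGL hij a := by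
  rw [MulAut.conj_apply, mul_inv_eq_iff_eq_mul]
  apply Units.ext
  simp [tGL, Matrix.transvection, mul_add, add_mul, Matrix.single_mul_single_of_ne,
    hjl.symm, hil.symm, ← Matrix.single_neg]
  abel

lemma conj_left {i j l : ι} (hij : i ≠ j) (hli : l ≠ i) (hlj : l ≠ j) (a b : R) :
    MulAut.conj (tGL hli b) (tGL hij a) = tGL hlj (b * a) * tGL hij a := by
  rw [MulAut.conj_apply, mul_inv_eq_iff_eq_mul]
  apply Units.ext
  simp [tGL, Matrix.transvection, mul_add, add_mul, Matrix.single_mul_single_of_ne, hij.symm,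
    hlj.symm]
  abel

/-- `z_{i,j}(a,b)`. -/
def zGL {i j : ι} (h : i ≠ j) (a b : R) : GL ι R := MulAut.conj (tGL h.symm b) (tGL h a)

lemma zGL_zero {i j : ι} (h : i ≠ j) (a : R) : zGL h a 0 = tGL h a := by
  simp [zGL, tGL_zero]

lemma conj_conj {G : Type*} [Group G] (t g x : G) :
    MulAut.conj t (MulAut.conj g x) = MulAut.conj (MulAut.conj t g) (MulAut.conj t x) := by
  simp only [MulAut.conj_apply]
  group

lemma zGL_reduce {A : Ideal R} (S : Subgroup (GL ι R))
    (hE : ∀ (i j : ι) (h : i ≠ j), ∀ a ∈ A, tGL h a ∈ S)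
    {i j v : ι} (hij : i ≠ j) (hiv : i ≠ v) (hjv : j ≠ v)
    (hi : ∀ a ∈ A, ∀ b, zGL hiv a b ∈ S) (hj : ∀ a ∈ A, ∀ b, zGL hjv a b ∈ S)
    (x : R) (hx : x ∈ A) (c : R) : zGL hij x c ∈ S := by
  have hx' : -x ∈ A := A.neg_mem hx
  have e0 : tGL hij x = MulAut.conj (tGL hjv.symm 1) (tGL hiv (-x)) * tGL hiv x := by
    rw [conj_right hiv hjv.symm hij, mul_assoc, tGL_mul, neg_add_cancel, tGL_zero]
    simp
  have e1 : ∀ x : R, MulAut.conj (tGL hij.symm c) (tGL hiv x) = tGL hjv (c * x) * tGL hiv x :=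
    fun x => conj_left hiv hij.symm hjv x c
  set y := tGL hiv.symm (-(1 * c)) * tGL hjv.symm (1 : R) with hy
  have e2 : MulAut.conj (tGL hij.symm c) (tGL hjv.symm 1) = y :=
    conj_right hjv.symm hij.symm hiv.symm 1 c
  have hyc : y = tGL hjv.symm (1 : R) * tGL hiv.symm (-(1 * c)) := by
    have := conj_comm (R := R) hjv.symm hiv.symm hjv hiv 1 (-(1 * c))
    rw [MulAut.conj_apply, mul_inv_eq_iff_eq_mul] at this
    exact this
  have e3 : zGL hij x c = MulAut.conj y (tGL hjv (c * -x) * tGL hiv (-x)) *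
      (tGL hjv (c * x) * tGL hiv x) := by
    unfold zGL
    rw [e0, map_mul, conj_conj, e2, e1, e1]
  rw [e3, map_mul]
  refine S.mul_mem (S.mul_mem ?_ ?_) (S.mul_mem (hE _ _ _ _ (A.mul_mem_left _ hx))
    (hE _ _ _ _ hx))
  · have ha : c * -x ∈ A := A.mul_mem_left _ hx'
    rw [hyc, map_mul, MulAut.mul_apply, conj_right hjv hiv.symm hij.symm, map_mul]
    refine S.mul_mem ?_ (hj _ ha _)
    rw [conj_left hij.symm hjv.symm hiv.symm]
    have ha' := A.neg_mem (A.mul_mem_right (-(1 * c)) ha)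
    exact S.mul_mem (hE _ _ _ _ (A.mul_mem_left _ ha')) (hE _ _ _ _ ha')
  · rw [hy, map_mul, MulAut.mul_apply, conj_right hiv hjv.symm hij, map_mul]
    refine S.mul_mem ?_ (hi _ hx' _)
    rw [conj_left hij hiv.symm hjv.symm]
    have ha' := A.neg_mem (A.mul_mem_right (1 : R) hx')
    exact S.mul_mem (hE _ _ _ _ (A.mul_mem_left _ ha')) (hE _ _ _ _ ha')

lemma conj_zGL {A : Ideal R} (S : Subgroup (GL ι R))
    (hE : ∀ (i j : ι) (h : i ≠ j), ∀ a ∈ A, tGL h a ∈ S)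
    {i j : ι} (hij : i ≠ j) (hz : ∀ a ∈ A, ∀ b, zGL hij a b ∈ S)
    {k l : ι} (hkl : k ≠ l) (h1 : ¬ (k = i ∧ l = j)) (h2 : ¬ (k = j ∧ l = i))
    (a : R) (ha : a ∈ A) (b c : R) : MulAut.conj (tGL hkl c) (zGL hij a b) ∈ S := by
  have cj : ∀ (l : ι) (hjl : j ≠ l) (hil : i ≠ l) (c : R),
      MulAut.conj (tGL hjl c) (zGL hij a b) ∈ S := fun l hjl hil c => by
    unfold zGL
    rw [conj_conj, conj_comm hij.symm hjl hij hjl.symm, conj_right hij hjl hil, map_mul]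
    refine S.mul_mem ?_ (hz a ha b)
    rw [conj_left hil hij.symm hjl]
    have ha' := A.neg_mem (A.mul_mem_right c ha)
    exact S.mul_mem (hE _ _ _ _ (A.mul_mem_left _ ha')) (hE _ _ _ _ ha')
  have ci : ∀ (k : ι) (hki : k ≠ i) (hkj : k ≠ j) (c : R),
      MulAut.conj (tGL hki c) (zGL hij a b) ∈ S := fun k hki hkj c => by
    unfold zGL
    rw [conj_conj, conj_comm hij.symm hki hki.symm hij, conj_left hij hki hkj, map_mul]
    refine S.mul_mem ?_ (hz a ha b)
    rw [conj_right hkj hij.symm hki]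
    have ha' := A.mul_mem_left c ha
    exact S.mul_mem (hE _ _ _ _ (A.neg_mem (A.mul_mem_right _ ha'))) (hE _ _ _ _ ha')
  by_cases hki : k = i
  · subst hki
    have hjl : j ≠ l := fun h => h1 ⟨rfl, h.symm⟩
    unfold zGL
    rw [conj_conj, conj_right hij.symm hkl hjl, conj_comm hij hkl hij.symm hkl.symm, map_mul,
      MulAut.mul_apply]
    exact cj l hjl hkl _
  by_cases hkj : k = j
  · subst hkj
    exact cj l hkl (fun h => h2 ⟨rfl, h.symm⟩) c
  by_cases hli : l = i
  · subst hli
    exact ci k hkl hkj c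
  by_cases hlj : l = j
  · subst hlj
    unfold zGL
    rw [conj_conj, conj_left hij.symm hkl hki, conj_comm hij hkl hkl.symm hij.symm, map_mul,
      MulAut.mul_apply]
    exact ci k hki hkj _
  · unfold zGL
    rw [conj_conj, conj_comm hij.symm hkl (Ne.symm hki) hlj, conj_comm hij hkl (Ne.symm hkj) hli]
    exact hz a ha b

/-- The relative elementary group is generated by the `z_{i,j}(a,b)`. -/
lemma relElemSub_le {A : Ideal R} (S : Subgroup (GL ι R))
    (hthird : ∀ i j : ι, ∃ v, i ≠ v ∧ j ≠ v)
    (hS : ∀ (i j : ι) (h : i ≠ j), ∀ a ∈ A, ∀ b, zGL h a b ∈ S) : relElemSub R ι A ≤ S := by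
  let Z : Subgroup (GL ι R) :=
    Subgroup.closure {g | ∃ (i j : ι) (h : i ≠ j) (a b : R), a ∈ A ∧ g = zGL h a b}
  have hZS : Z ≤ S := by
    rw [Subgroup.closure_le]
    rintro _ ⟨i, j, h, a, b, ha, rfl⟩
    exact hS i j h a ha b
  have hz : ∀ (i j : ι) (h : i ≠ j), ∀ a ∈ A, ∀ b, zGL h a b ∈ Z := fun i j h a ha b =>
    Subgroup.subset_closure ⟨i, j, h, a, b, ha, rfl⟩
  have hE : ∀ (i j : ι) (h : i ≠ j), ∀ a ∈ A, tGL h a ∈ Z := fun i j h a ha => by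
    rw [← zGL_zero]; exact hz i j h a ha 0
  have hconj : ∀ (k l : ι) (hkl : k ≠ l) (c : R),
      Z ≤ Z.comap (MulAut.conj (tGL hkl c)).toMonoidHom := by
    intro k l hkl c
    have opp : ∀ (a : R), a ∈ A → ∀ b, zGL hkl.symm a b ∈
        Z.comap (MulAut.conj (tGL hkl c)).toMonoidHom := fun a ha b => by
      have : MulAut.conj (tGL hkl c) (zGL hkl.symm a b) = zGL hkl.symm a (c + b) := by
        unfold zGL
        rw [← MulAut.mul_apply, ← map_mul, tGL_mul]
      change MulAut.conj (tGL hkl c) (zGL hkl.symm a b) ∈ Z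
      rw [this]
      exact hz _ _ _ a ha _
    have gen : ∀ (i j : ι) (h : i ≠ j) (a : R), a ∈ A → ∀ b, ¬ (k = i ∧ l = j) →
        zGL h a b ∈ Z.comap (MulAut.conj (tGL hkl c)).toMonoidHom := fun i j h a ha b h1 => by
      by_cases h2 : k = j ∧ l = i
      · obtain ⟨rfl, rfl⟩ := h2
        exact opp a ha b
      · exact conj_zGL Z hE h (hz i j h) hkl h1 h2 a ha b c
    have hE' : ∀ (i j : ι) (h : i ≠ j), ∀ a ∈ A, tGL h a ∈
        Z.comap (MulAut.conj (tGL hkl c)).toMonoidHom := fun i j h a ha => by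
      by_cases h1 : k = i ∧ l = j
      · obtain ⟨rfl, rfl⟩ := h1
        change MulAut.conj (tGL hkl c) (tGL hkl a) ∈ Z
        rw [conj_comm hkl hkl hkl.symm hkl.symm]
        exact hE _ _ _ a ha
      · rw [← zGL_zero h]
        exact gen i j h a ha 0 h1
    rw [Subgroup.closure_le]
    rintro _ ⟨i, j, h, a, b, ha, rfl⟩
    by_cases h1 : k = i ∧ l = j
    · obtain ⟨rfl, rfl⟩ := h1
      obtain ⟨v, hkv, hlv⟩ := hthird k l
      exact zGL_reduce _ hE' hkl hkv hlv
        (fun a ha b => gen _ _ _ a ha b fun h => hlv h.2)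
        (fun a ha b => gen _ _ _ a ha b fun h => hkl h.1) a ha b
    · exact gen i j h a ha b h1
  have hnorm : elemSubFull R ι ≤ Subgroup.normalizer (Z : Set (GL ι R)) := by
    unfold elemSubFull
    rw [Subgroup.closure_le]
    rintro _ ⟨k, l, hkl, c, rfl⟩
    rw [SetLike.mem_coe, Subgroup.mem_normalizer_iff]
    intro x
    refine ⟨fun hx => hconj k l hkl c hx, fun hx => ?_⟩
    have := hconj k l hkl (-c) hx
    change tGL hkl (-c) * _ * (tGL hkl (-c))⁻¹ ∈ Z at this
    rw [← tGL_inv] at this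
    convert this using 1
    group
  refine le_trans ?_ hZS
  unfold relElemSub closUnder
  rw [Subgroup.closure_le]
  rintro _ ⟨x, hx, f, hf, rfl⟩
  refine (Subgroup.mem_normalizer_iff.1 (hnorm hf) x).1 ?_
  have : elemSub R ι A ≤ Z := by
    unfold elemSub
    rw [Subgroup.closure_le]
    rintro _ ⟨i, j, h, a, ha, rfl⟩
    exact hE i j h a ha
  exact this hx

end elementary

section singles

variable {R : Type*} [CommRing R] {ι : Type*} [Fintype ι] [DecidableEq ι]

lemma single_mul_row {w : Matrix ι ι R} {v j : ι} {e : R}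
    (h : ∀ l, w v l = (1 : Matrix ι ι R) v l + e * (1 : Matrix ι ι R) j l) (i : ι) (a : R) :
    Matrix.single i v a * w = Matrix.single i v a + Matrix.single i j (a * e) := by
  ext p q
  by_cases hp : i = p <;>
    simp [Matrix.mul_apply, Matrix.single_apply, hp, h, Matrix.one_apply, mul_add]

lemma mul_single_col {w : Matrix ι ι R} {i v : ι} {e : R}
    (h : ∀ k, w k i = (1 : Matrix ι ι R) k i + e * (1 : Matrix ι ι R) k v) (j : ι) (a : R) :
    w * Matrix.single i j a = Matrix.single i j a + Matrix.single v j (e * a) := by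
  ext p q
  by_cases hq : j = q <;>
    simp [Matrix.mul_apply, Matrix.single_apply, hq, h, Matrix.one_apply, add_mul,
      eq_comm]

lemma single_mul_row_triv {w : Matrix ι ι R} {v : ι}
    (h : ∀ l, w v l = (1 : Matrix ι ι R) v l) (i : ι) (a : R) :
    Matrix.single i v a * w = Matrix.single i v a := by
  have := single_mul_row (w := w) (v := v) (j := v) (e := 0) (by simpa using h) i a
  simpa using this

lemma mul_single_col_triv {w : Matrix ι ι R} {i : ι}
    (h : ∀ k, w k i = (1 : Matrix ι ι R) k i) (j : ι) (a : R) :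
    w * Matrix.single i j a = Matrix.single i j a := by
  have := mul_single_col (w := w) (i := i) (v := i) (e := 0) (by simpa using h) j a
  simpa using this

end singles

/-- The Cauchy–Binet homomorphism. -/
def wedgeHom (R : Type*) [CommRing R] (n m : ℕ) : GL (Fin n) R →* GL (Idx n m) R :=
  Units.map { toFun := extPow n m, map_one' := extPow_one n m, map_mul' := extPow_mul n m }

lemma wedgeHom_apply {R : Type*} [CommRing R] {n m : ℕ} {k l : Fin n} (h : k ≠ l) (c : R)
    (K J : Idx n m) : (wedgeHom R n m (tGL h c)).val K J =
      (1 : Matrix (Idx n m) (Idx n m) R) K J + c * sgnX R k l K J :=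
  extPow_transvection k l c K J

section wedge

variable {R : Type*} [CommRing R] {n m : ℕ}

lemma sgnX_row {k l : Fin n} {K J : Idx n m}
    (hJ : J.1 = insert l (K.1.erase k)) (L : Idx n m) :
    sgnX R k l K L = sgnX R k l K J * (1 : Matrix (Idx n m) (Idx n m) R) J L := by
  by_cases h : J = L
  · subst h; simp
  · rw [Matrix.one_apply_ne h, mul_zero]
    refine sgnX_zero _ _ _ _ fun h' => h (Subtype.ext (hJ.trans h'.2.2.symm))

lemma sgnX_col {k l : Fin n} {K J : Idx n m} (hk : k ∈ K.1) (hl : l ∉ K.1)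
    (hJ : J.1 = insert l (K.1.erase k)) (L : Idx n m) :
    sgnX R k l L J = sgnX R k l K J * (1 : Matrix (Idx n m) (Idx n m) R) L K := by
  by_cases h : L = K
  · subst h; simp
  · rw [Matrix.one_apply_ne h, mul_zero]
    refine sgnX_zero _ _ _ _ fun h' => h (Subtype.ext ?_)
    obtain ⟨h1, h2, h3⟩ := h'
    have e : L.1.erase k = K.1.erase k := by
      rw [← Finset.erase_insert h2, ← h3, hJ, Finset.erase_insert]
      exact fun h => hl (Finset.mem_of_mem_erase h)
    rw [← Finset.insert_erase h1, e, Finset.insert_erase hk]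

lemma conj_wedge_move {k l : Fin n} (hkl : k ≠ l) {I V J : Idx n m} (hIV : I ≠ V) (hIJ : I ≠ J)
    (hlI : l ∉ I.1) (hkJ : k ∉ J.1) (hk : k ∈ V.1) (hl : l ∉ V.1)
    (hJ : J.1 = insert l (V.1.erase k)) (x : R) :
    MulAut.conj (wedgeHom R n m (tGL hkl 1)) (tGL hIV x) =
      tGL hIJ (-(x * sgnX R k l V J)) * tGL hIV x := by
  rw [MulAut.conj_apply, mul_inv_eq_iff_eq_mul]
  apply Units.ext
  have hcol := mul_single_col_triv (w := (wedgeHom R n m (tGL hkl 1)).val) (i := I) (fun K => by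
    rw [wedgeHom_apply, sgnX_zero, mul_zero, add_zero]
    rintro ⟨-, -, h⟩
    exact hlI (h ▸ Finset.mem_insert_self _ _))
  have hrowJ := single_mul_row_triv (w := (wedgeHom R n m (tGL hkl 1)).val) (v := J) (fun K => by
    rw [wedgeHom_apply, sgnX_zero, mul_zero, add_zero]
    exact fun h => hkJ h.1)
  have hrowV := single_mul_row (w := (wedgeHom R n m (tGL hkl 1)).val) (v := V) (j := J)
    (e := sgnX R k l V J) (fun K => by
      rw [wedgeHom_apply, one_mul, sgnX_row hJ])
  simp only [Units.val_mul]
  generalize (wedgeHom R n m (tGL hkl 1)).val = w at *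
  simp only [tGL, Matrix.transvection, mul_add, add_mul, mul_one, one_mul, hcol, hrowV, hrowJ,
    Matrix.single_mul_single_of_ne _ _ _ _ hIJ.symm, ← Matrix.single_neg, neg_mul, zero_mul]
  abel

lemma conj_wedge_base {k l : Fin n} (hkl : k ≠ l) {I V : Idx n m} (hIV : I ≠ V)
    (hkI : k ∉ I.1) (hk : k ∈ V.1) (hl : l ∉ V.1)
    (hI : I.1 = insert l (V.1.erase k)) (x c : R) :
    MulAut.conj (wedgeHom R n m (tGL hkl c)) (tGL hIV x) = zGL hIV x (c * sgnX R k l V I) := by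
  set b := c * sgnX R k l V I with hb
  set w := wedgeHom R n m (tGL hkl c) with hw
  have hcol := mul_single_col (w := w.val) (i := I) (v := V) (e := b) (fun K => by
    rw [wedgeHom_apply, sgnX_col hk hl hI, hb, mul_assoc])
  have hrowI := single_mul_row_triv (w := w.val) (v := I) (fun K => by
    rw [wedgeHom_apply, sgnX_zero, mul_zero, add_zero]
    exact fun h => hkI h.1)
  have hrowV := single_mul_row (w := w.val) (v := V) (j := I) (e := b) (fun K => by
    rw [wedgeHom_apply, sgnX_row hI, hb, mul_assoc])
  have key : (tGL hIV.symm (-b) * w) * tGL hIV x = tGL hIV x * (tGL hIV.symm (-b) * w) := by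
    apply Units.ext
    simp only [Units.val_mul]
    generalize w.val = w at *
    simp only [tGL, Matrix.transvection, mul_add, add_mul, mul_one, one_mul, hcol, hrowV, hrowI,
      Matrix.single_mul_single_same, ← Matrix.single_neg, neg_mul, mul_neg]
    abel
  have hu : MulAut.conj (tGL hIV.symm (-b) * w) (tGL hIV x) = tGL hIV x := by
    rw [MulAut.conj_apply, mul_inv_eq_iff_eq_mul, key]
  have hw' : w = tGL hIV.symm b * (tGL hIV.symm (-b) * w) := by
    rw [← mul_assoc, tGL_mul, add_neg_cancel, tGL_zero, one_mul]
  rw [hw', map_mul, MulAut.mul_apply, hu, zGL]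

/-- If `W` normalizes `S ⊇ E(N,A)`, then all `z_{I,J}` are in `S`. -/
lemma zGL_mem {A : Ideal R} (S : Subgroup (GL (Idx n m) R))
    (hE : ∀ (I J : Idx n m) (h : I ≠ J), ∀ a ∈ A, tGL h a ∈ S)
    (hW : ∀ (k l : Fin n) (h : k ≠ l) (c : R), ∀ x ∈ S,
      MulAut.conj (wedgeHom R n m (tGL h c)) x ∈ S) (d : ℕ) :
    ∀ (I J : Idx n m) (h : I ≠ J), (I.1 \ J.1).card = d → ∀ a ∈ A, ∀ b, zGL h a b ∈ S := by
  have base : ∀ (I V : Idx n m) (h : I ≠ V) (i j : Fin n), i ∈ I.1 → j ∉ I.1 →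
      V.1 = insert j (I.1.erase i) → ∀ a ∈ A, ∀ b, zGL h a b ∈ S := by
    intro I V h i j hi hj hV a ha b
    have hij : j ≠ i := by rintro rfl; exact hj hi
    have hjV : j ∈ V.1 := by rw [hV]; exact Finset.mem_insert_self _ _
    have hiV : i ∉ V.1 := by rw [hV]; simp [hij.symm]
    have hIV : I.1 = insert i (V.1.erase j) := by
      rw [hV, Finset.erase_insert (by simp [hj]), Finset.insert_erase hi]
    obtain ⟨u, hu⟩ := (sgnX_unit (R := R) j i V I hjV hiV hIV).exists_left_inv
    have := conj_wedge_base (R := R) hij h hj hjV hiV hIV a (b * u)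
    rw [mul_assoc, hu, mul_one] at this
    rw [← this]
    exact hW _ _ _ _ _ (hE _ _ _ a ha)
  induction d with
  | zero =>
    intro I J h hd
    rw [Finset.card_eq_zero, Finset.sdiff_eq_empty_iff_subset] at hd
    exact absurd (Subtype.ext (Finset.eq_of_subset_of_card_le hd (by rw [I.2, J.2]))) h
  | succ d ih =>
    intro I J h hd a ha b
    have hd' : (J.1 \ I.1).card = d + 1 := by
      rw [← hd]; exact Finset.card_sdiff_comm (by rw [I.2, J.2])
    obtain ⟨i, hi⟩ := Finset.card_pos.1 (by omega : 0 < (I.1 \ J.1).card)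
    obtain ⟨j, hj⟩ := Finset.card_pos.1 (by omega : 0 < (J.1 \ I.1).card)
    obtain ⟨hiI, hiJ⟩ := Finset.mem_sdiff.1 hi
    obtain ⟨hjJ, hjI⟩ := Finset.mem_sdiff.1 hj
    let V : Idx n m := ⟨insert j (I.1.erase i), by
      rw [Finset.card_insert_of_notMem (by simp [hjI]), Finset.card_erase_add_one hiI, I.2]⟩
    have hIV : I ≠ V := fun e => hjI (by rw [e]; exact Finset.mem_insert_self _ _)
    by_cases hJV : J = V
    · subst hJV
      exact base I _ h i j hiI hjI rfl a ha b
    · refine zGL_reduce S hE h hIV hJV (base I V hIV i j hiI hjI rfl) (ih J V hJV ?_) a ha b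
      have : J.1 \ V.1 = (J.1 \ I.1).erase j := by
        ext p
        simp only [V, Finset.mem_sdiff, Finset.mem_insert, Finset.mem_erase]
        constructor
        · rintro ⟨h1, h2⟩
          refine ⟨fun e => h2 (Or.inl e), h1, fun h3 => h2 (Or.inr ⟨?_, h3⟩)⟩
          rintro rfl
          exact hiJ h1
        · rintro ⟨h1, h2, h3⟩
          exact ⟨h2, by tauto⟩
      rw [this, Finset.card_erase_of_mem hj, hd']
      rfl

lemma exists_fresh (hm : 2 ≤ m) (hn : 3 * m ≤ n) (I J : Idx n m) : ∃ v, v ∉ I.1 ∧ v ∉ J.1 := by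
  by_contra! hcon
  have : (Finset.univ : Finset (Fin n)) ⊆ I.1 ∪ J.1 := fun v _ => by
    by_cases h : v ∈ I.1
    · exact Finset.mem_union_left _ h
    · exact Finset.mem_union_right _ (hcon v h)
  have h1 := Finset.card_le_card this
  have h2 := Finset.card_union_le I.1 J.1
  rw [I.2, J.2] at h2
  rw [Finset.card_univ, Fintype.card_fin] at h1
  omega

end wedge

/-- For `n ≥ 3m` and any ideal `A ⊴ R`, the group
`E∧^m E(n,R,A) = ∧^m E(n,R) · E(N,R,A)` (the subgroup generated by `∧^m E(n,R)` and the
relative elementary group `E(N,R,A)`) is perfect. -/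
theorem EwedgeE_perfect {R : Type*} [CommRing R] (h2 : IsUnit (2 : R))
    {n m : ℕ} (hm : 2 ≤ m) (hn : 3 * m ≤ n) (A : Ideal R) :
    ⁅wedgeElem R n m ⊔ relElemSub R (Idx n m) A, wedgeElem R n m ⊔ relElemSub R (Idx n m) A⁆ =
      wedgeElem R n m ⊔ relElemSub R (Idx n m) A := by
  classical
  set H := wedgeElem R n m ⊔ relElemSub R (Idx n m) A with hH
  have hcm : ∀ a ∈ H, ∀ b ∈ H, a * b * a⁻¹ * b⁻¹ ∈ ⁅H, H⁆ := fun a ha b hb =>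
    Subgroup.commutator_mem_commutator ha hb
  have hDH : ⁅H, H⁆ ≤ H := Subgroup.commutator_le.2 fun a ha b hb => by
    rw [commutatorElement_def]
    exact H.mul_mem (H.mul_mem (H.mul_mem ha hb) (H.inv_mem ha)) (H.inv_mem hb)
  have hDn : ∀ g ∈ H, ∀ x ∈ ⁅H, H⁆, MulAut.conj g x ∈ ⁅H, H⁆ := fun g hg x hx => by
    have h1 := Subgroup.mul_mem _ (hcm g hg x (hDH hx)) hx
    rw [inv_mul_cancel_right] at h1
    exact h1
  have hWH : ∀ (k l : Fin n) (h : k ≠ l) (c : R), wedgeHom R n m (tGL h c) ∈ H :=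
    fun k l h c => Subgroup.mem_sup_left (Subgroup.subset_closure ⟨k, l, h, c, rfl⟩)
  have hEH : ∀ (I J : Idx n m) (h : I ≠ J), ∀ a ∈ A, tGL h a ∈ H := fun I J h a ha => by
    refine Subgroup.mem_sup_right (Subgroup.subset_closure
      ⟨tGL h a, Subgroup.subset_closure ⟨I, J, h, a, ha, rfl⟩, 1, Subgroup.one_mem _, ?_⟩)
    simp
  have hE : ∀ (I J : Idx n m) (h : I ≠ J), ∀ a ∈ A, tGL h a ∈ ⁅H, H⁆ := fun I J h a ha => by
    obtain ⟨l, hlJ, hlI⟩ : ∃ l ∈ J.1, l ∉ I.1 := by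
      by_contra! hcon
      exact h (Subtype.ext (Finset.eq_of_subset_of_card_le hcon (by rw [I.2, J.2])).symm)
    obtain ⟨k, hkI, hkJ⟩ := exists_fresh hm hn I J
    have hkl : k ≠ l := by rintro rfl; exact hkJ hlJ
    let V : Idx n m := ⟨insert k (J.1.erase l), by
      rw [Finset.card_insert_of_notMem (by simp [hkJ]), Finset.card_erase_add_one hlJ, J.2]⟩
    have hkV : k ∈ V.1 := Finset.mem_insert_self _ _
    have hlV : l ∉ V.1 := by simp [V, hkl.symm]
    have hJV : J.1 = insert l (V.1.erase k) := by
      change J.1 = insert l ((insert k (J.1.erase l)).erase k)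
      rw [Finset.erase_insert (by simp [hkJ]), Finset.insert_erase hlJ]
    have hIV : I ≠ V := fun e => hkI (by rw [e]; exact hkV)
    obtain ⟨u, hu⟩ := (sgnX_unit (R := R) k l V J hkV hlV hJV).exists_left_inv
    have key := conj_wedge_move (R := R) hkl hIV h hlI hkJ hkV hlV hJV (-a * u)
    rw [mul_assoc, hu, mul_one, neg_neg] at key
    have e : tGL h a = wedgeHom R n m (tGL hkl 1) * tGL hIV (-a * u) *
        (wedgeHom R n m (tGL hkl 1))⁻¹ * (tGL hIV (-a * u))⁻¹ :=
      eq_mul_inv_of_mul_eq key.symm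
    rw [e]
    exact hcm _ (hWH _ _ _ _) _
      (hEH _ _ _ _ (A.mul_mem_right _ (A.neg_mem ha)))
  refine le_antisymm hDH (sup_le ?_ ?_)
  · unfold wedgeElem
    rw [Subgroup.closure_le]
    rintro g ⟨i, j, hij, x, hg⟩
    have hg' : g = wedgeHom R n m (tGL hij x) := Units.ext hg
    obtain ⟨h, hih, hjh⟩ : ∃ h, h ≠ i ∧ h ≠ j := by
      have : ({i, j} : Finset (Fin n)).card < Fintype.card (Fin n) := by
        rw [Fintype.card_fin]
        exact lt_of_le_of_lt Finset.card_le_two (by omega)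
      obtain ⟨h, hh⟩ := Finset.exists_mem_notMem_of_card_lt_card
        (by rwa [← Finset.card_univ] at this)
      exact ⟨h, by simpa using hh⟩
    have key := conj_left (R := R) hjh hih.symm hij 1 x
    rw [mul_one] at key
    have e : tGL hij x = tGL hih.symm x * tGL hjh 1 * (tGL hih.symm x)⁻¹ * (tGL hjh 1)⁻¹ :=
      eq_mul_inv_of_mul_eq key.symm
    rw [hg', e, map_mul, map_mul, map_mul, map_inv, map_inv]
    exact hcm _ (hWH _ _ _ _) _ (hWH _ _ _ _)
  · refine relElemSub_le _ (fun I J => ?_) fun I J h a ha b => zGL_mem _ hE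
      (fun k l h c x hx => hDn _ (hWH _ _ _ _) x hx) _ I J h rfl a ha b
    obtain ⟨v, hvI, hvJ⟩ := exists_fresh hm hn I J
    obtain ⟨i, hi⟩ := Finset.card_pos.1 (by rw [I.2]; omega : 0 < I.1.card)
    refine ⟨⟨insert v (I.1.erase i), by
      rw [Finset.card_insert_of_notMem (by simp [hvI]), Finset.card_erase_add_one hi, I.2]⟩, ?_, ?_⟩
    · exact fun e => hvI (by rw [e]; exact Finset.mem_insert_self _ _)
    · exact fun e => hvJ (by rw [e]; exact Finset.mem_insert_self _ _)
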